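/- arXiv:0906.1439 — 3 statements merged into one kernel-verified Lean document; each statement's English description precedes it below -/
import Mathlib

section
/- With the same data as above (A, p, u, C, H, α), the equation p_{z̄} = 2(1−α) e^{2u} C A holds, where p_{z̄} denotes the Wirtinger derivative ∂p/∂z̄. -/
/-- `D(z) = 4(1−α)|z|² + (H²+α)(|z|²+1)²`. -/
noncomputable def Dd (H α : ℝ) (z : ℂ) : ℝ :=
  4 * (1 - α) * Complex.normSq z + (H ^ 2 + α) * (Complex.normSq z + 1) ^ 2

/-- `A(z) = −2(H + i√α) z̄ / D(z)`. -/
noncomputable def Af (H α : ℝ) (z : ℂ) : ℂ :=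
  -2 * ((H : ℂ) + (Real.sqrt α : ℂ) * Complex.I) * (starRingEnd ℂ) z / (Dd H α z : ℂ)

/-- `C(z) = (|z|² − 1)/(|z|² + 1)`. -/
noncomputable def Cf (z : ℂ) : ℝ := (Complex.normSq z - 1) / (Complex.normSq z + 1)

/-- `e^{2u(z)} = 4(|z|²+1)²(H²+α)/D(z)²`. -/
noncomputable def e2u (H α : ℝ) (z : ℂ) : ℝ :=
  4 * (Complex.normSq z + 1) ^ 2 * (H ^ 2 + α) / (Dd H α z) ^ 2

/-- `p(z) = (2(1−α)/(H + i√α)) A(z)²`. -/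
noncomputable def pf (H α : ℝ) (z : ℂ) : ℂ :=
  2 * ((1 : ℂ) - α) / ((H : ℂ) + (Real.sqrt α : ℂ) * Complex.I) * (Af H α z) ^ 2

/-- Wirtinger derivative `∂_{z̄} = (∂_x + i ∂_y)/2`. -/
noncomputable def dzbar (f : ℂ → ℂ) (z : ℂ) : ℂ :=
  (fderiv ℝ f z 1 + Complex.I * fderiv ℝ f z Complex.I) / 2

/-- Wirtinger derivative `∂_z = (∂_x − i ∂_y)/2`. -/
noncomputable def dz (f : ℂ → ℂ) (z : ℂ) : ℂ :=
  (fderiv ℝ f z 1 - Complex.I * fderiv ℝ f z Complex.I) / 2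

theorem dzbar_mul {f g : ℂ → ℂ} {z : ℂ} (hf : DifferentiableAt ℝ f z)
    (hg : DifferentiableAt ℝ g z) :
    dzbar (fun w => f w * g w) z = dzbar f z * g z + f z * dzbar g z := by
  simp only [dzbar, fderiv_fun_mul hf hg, add_apply,
    smul_apply, smul_eq_mul]
  ring

theorem dzbar_const (c z : ℂ) : dzbar (fun _ => c) z = 0 := by
  simp [dzbar]

theorem dzbar_add {f g : ℂ → ℂ} {z : ℂ} (hf : DifferentiableAt ℝ f z)
    (hg : DifferentiableAt ℝ g z) :
    dzbar (fun w => f w + g w) z = dzbar f z + dzbar g z := by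
  simp only [dzbar, fderiv_fun_add hf hg, add_apply]
  ring

theorem dzbar_const_mul (c : ℂ) {f : ℂ → ℂ} {z : ℂ} (hf : DifferentiableAt ℝ f z) :
    dzbar (fun w => c * f w) z = c * dzbar f z := by
  rw [dzbar_mul (by fun_prop) hf, dzbar_const]
  ring

theorem dzbar_id (z : ℂ) : dzbar (fun w => w) z = 0 := by
  simp [dzbar]

theorem differentiableAt_conj (z : ℂ) : DifferentiableAt ℝ (fun w => (starRingEnd ℂ) w) z :=
  Complex.conjCLE.differentiableAt

theorem dzbar_conj (z : ℂ) : dzbar (fun w => (starRingEnd ℂ) w) z = 1 := by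
  have h : fderiv ℝ (fun w => (starRingEnd ℂ) w) z = (Complex.conjCLE : ℂ →L[ℝ] ℂ) :=
    Complex.conjCLE.hasFDerivAt.fderiv
  simp [dzbar, h]

theorem Dd_cast (H α : ℝ) (z : ℂ) :
    (Dd H α z : ℂ) = 4 * (1 - α) * (z * (starRingEnd ℂ) z)
      + (H ^ 2 + α) * ((z * (starRingEnd ℂ) z + 1) * (z * (starRingEnd ℂ) z + 1)) := by
  rw [Complex.mul_conj, Dd]
  push_cast
  ring

theorem differentiableAt_Dd (H α : ℝ) (z : ℂ) :
    DifferentiableAt ℝ (fun w => (Dd H α w : ℂ)) z := by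
  have h := differentiableAt_conj z
  simp only [Dd_cast]
  fun_prop

theorem dzbar_Dd (H α : ℝ) (z : ℂ) :
    dzbar (fun w => (Dd H α w : ℂ)) z
      = 4 * (1 - α) * z + 2 * (H ^ 2 + α) * (z * (starRingEnd ℂ) z + 1) * z := by
  have h := differentiableAt_conj z
  have hr : dzbar (fun w => w * (starRingEnd ℂ) w) z = z := by
    rw [dzbar_mul (by fun_prop) h, dzbar_id, dzbar_conj]
    ring
  have hr' : dzbar (fun w => w * (starRingEnd ℂ) w + 1) z = z := by
    rw [dzbar_add (by fun_prop) (by fun_prop), hr, dzbar_const, add_zero]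
  simp only [Dd_cast]
  rw [dzbar_add (by fun_prop) (by fun_prop), dzbar_const_mul _ (by fun_prop),
    dzbar_const_mul _ (by fun_prop), hr, dzbar_mul (by fun_prop) (by fun_prop), hr']
  ring

theorem differentiableAt_Af {H α : ℝ} {z : ℂ} (hD : Dd H α z ≠ 0) :
    DifferentiableAt ℝ (Af H α) z := by
  have h := differentiableAt_conj z
  have h' := differentiableAt_Dd H α z
  have h0 : (Dd H α z : ℂ) ≠ 0 := by exact_mod_cast hD
  unfold Af
  simp only [div_eq_mul_inv]
  exact (h.const_mul _).mul (h'.inv h0)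

/-- The derivative of `A` comes from differentiating the identity `A D = −2(H + i√α) z̄`. -/
theorem dzbar_Af {H α : ℝ} (hD : ∀ z : ℂ, Dd H α z ≠ 0) (z : ℂ) :
    dzbar (Af H α) z = 2 * ((H : ℂ) + (Real.sqrt α : ℂ) * Complex.I) * (H ^ 2 + α)
      * ((z * (starRingEnd ℂ) z) ^ 2 - 1) / (Dd H α z : ℂ) ^ 2 := by
  have hD' (w : ℂ) : (Dd H α w : ℂ) ≠ 0 := by exact_mod_cast hD w
  have hA (w : ℂ) : Af H α w * (Dd H α w : ℂ)
      = -2 * ((H : ℂ) + (Real.sqrt α : ℂ) * Complex.I) * (starRingEnd ℂ) w :=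
    div_mul_cancel₀ _ (hD' w)
  have key := dzbar_mul (differentiableAt_Af (hD z)) (differentiableAt_Dd H α z)
  simp only [hA] at key
  rw [dzbar_const_mul _ (differentiableAt_conj z), dzbar_conj, dzbar_Dd] at key
  rw [eq_div_iff (pow_ne_zero 2 (hD' z))]
  have hAz := hA z
  have hDz := Dd_cast H α z
  linear_combination (-(Dd H α z : ℂ)) * key
    - (4 * (1 - α) * z + 2 * (H ^ 2 + α) * (z * (starRingEnd ℂ) z + 1) * z) * hAz
    - 2 * ((H : ℂ) + (Real.sqrt α : ℂ) * Complex.I) * hDz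

theorem stmt5 (H α : ℝ) (hH : 0 ≤ H) (hα : 0 < α)
    (hD : ∀ z : ℂ, 0 < Dd H α z) (z : ℂ) :
    dzbar (pf H α) z
      = 2 * ((1 : ℂ) - α) * (e2u H α z : ℂ) * (Cf z : ℂ) * Af H α z := by
  have hD' (w : ℂ) : Dd H α w ≠ 0 := (hD w).ne'
  have hDz : (Dd H α z : ℂ) ≠ 0 := by exact_mod_cast hD' z
  have hA := differentiableAt_Af (hD' z)
  have hc : (H : ℂ) + (Real.sqrt α : ℂ) * Complex.I ≠ 0 := by
    intro h
    have him := congrArg Complex.im h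
    simp at him
    exact (Real.sqrt_pos.mpr hα).ne' him
  have hr : (Complex.normSq z : ℂ) + 1 ≠ 0 := by
    have : Complex.normSq z + 1 ≠ 0 := by linarith [Complex.normSq_nonneg z]
    exact_mod_cast this
  unfold pf
  simp only [pow_two (Af H α _)]
  rw [dzbar_const_mul _ (hA.fun_mul hA), dzbar_mul hA hA, dzbar_Af hD', Complex.mul_conj]
  simp only [e2u, Cf]
  push_cast
  field_simp
  ring
end

section
/- With the same data, the equation A_{z̄} = (e^{2u} C / 2)(H + i√α) holds for all z ∈ ℂ. -/
theorem ofReal_Dd (H α : ℝ) (z : ℂ) :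
    (Dd H α z : ℂ) = 4 * (1 - (α : ℂ)) * (z * (starRingEnd ℂ) z)
      + ((H : ℂ) ^ 2 + α) * ((z * (starRingEnd ℂ) z + 1) * (z * (starRingEnd ℂ) z + 1)) := by
  rw [Complex.mul_conj, Dd]
  push_cast
  ring

theorem fderiv_Af_apply (H α : ℝ) (z v : ℂ) (hD : Dd H α z ≠ 0) :
    fderiv ℝ (Af H α) z v
      = -2 * ((H : ℂ) + (Real.sqrt α : ℂ) * Complex.I)
        * ((starRingEnd ℂ) v * Dd H α z - (starRingEnd ℂ) z
          * (4 * (1 - (α : ℂ)) + 2 * ((H : ℂ) ^ 2 + α) * (z * (starRingEnd ℂ) z + 1))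
          * (v * (starRingEnd ℂ) z + z * (starRingEnd ℂ) v)) / (Dd H α z : ℂ) ^ 2 := by
  have h_conj : HasFDerivAt (fun w : ℂ => (starRingEnd ℂ) w) (Complex.conjCLE : ℂ →L[ℝ] ℂ) z :=
    Complex.conjCLE.hasFDerivAt
  have h_sq := (hasFDerivAt_id (𝕜 := ℝ) z).fun_mul h_conj
  have h_add := h_sq.add_const (1 : ℂ)
  have h_den := (h_sq.const_mul (4 * (1 - (α : ℂ)))).fun_add
    ((h_add.fun_mul h_add).const_mul ((H : ℂ) ^ 2 + α))
  have h_num := h_conj.const_mul (-2 * ((H : ℂ) + (Real.sqrt α : ℂ) * Complex.I))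
  have h_ne : (Dd H α z : ℂ) ≠ 0 := by exact_mod_cast hD
  rw [ofReal_Dd] at h_ne
  have h_div := h_num.fun_mul ((hasDerivAt_inv h_ne).comp_hasFDerivAt z h_den)
  have h_Af := h_div.congr_of_eventuallyEq (f₁ := Af H α) <| .of_forall fun w => by
    simp only [Af, ofReal_Dd, div_eq_mul_inv, Function.comp_apply, id_eq]
  rw [h_Af.fderiv, ofReal_Dd]
  simp
  field_simp
  ring

theorem stmt6 (H α : ℝ) (hH : 0 ≤ H) (hα : 0 < α)
    (hD : ∀ z : ℂ, 0 < Dd H α z) (z : ℂ) :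
    dzbar (Af H α) z
      = (e2u H α z : ℂ) * (Cf z : ℂ) / 2 * ((H : ℂ) + (Real.sqrt α : ℂ) * Complex.I) := by
  have hDz : (Dd H α z : ℂ) ≠ 0 := by exact_mod_cast (hD z).ne'
  have hw : (Complex.normSq z : ℂ) + 1 ≠ 0 := by
    exact_mod_cast (add_pos_of_nonneg_of_pos (Complex.normSq_nonneg z) one_pos).ne'
  rw [dzbar, fderiv_Af_apply H α z 1 (hD z).ne', fderiv_Af_apply H α z Complex.I (hD z).ne',
    e2u, Cf]
  push_cast
  rw [← Complex.mul_conj] at hw ⊢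
  simp only [map_one, Complex.conj_I]
  field_simp
  rw [ofReal_Dd]
  ring_nf
  simp only [Complex.I_sq, Complex.I_pow_three]
  ring
end

section
/- Let ε = −1 and for t ∈ [0,1] define α(t) = (t⁴ + 4t + 3 + 2(1+t)√(2(1+t²))) / (t⁴ + 2t² + 8t + 1). Then the minimum of α(t) over t ∈ [0,1] is 4/3, attained at t = 1; in particular α(t) ≥ 4/3 > 1 for all t ∈ [0,1]. Consequently, for every 1 < α ≤ 4/3 and every t ∈ [0,1], P_t(α) = −(t⁴+2t²+8t+1)α² + 2(t⁴+4t+3)α − (1−t²)² ≥ 0. -/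
theorem stmt16 (αf : ℝ → ℝ)
    (hαf : ∀ t, αf t = (t ^ 4 + 4 * t + 3 + 2 * (1 + t) * Real.sqrt (2 * (1 + t ^ 2)))
        / (t ^ 4 + 2 * t ^ 2 + 8 * t + 1)) :
    αf 1 = 4 / 3 ∧ (∀ t ∈ Set.Icc (0 : ℝ) 1, 4 / 3 ≤ αf t) ∧
    (∀ α : ℝ, 1 < α → α ≤ 4 / 3 → ∀ t ∈ Set.Icc (0 : ℝ) 1,
      0 ≤ -(t ^ 4 + 2 * t ^ 2 + 8 * t + 1) * α ^ 2
          + 2 * (t ^ 4 + 4 * t + 3) * α - (1 - t ^ 2) ^ 2) := by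
  refine ⟨?_, ?_, ?_⟩
  · have h : Real.sqrt (2 * (1 + 1 ^ 2)) = 2 := by
      rw [show (2 * (1 + 1 ^ 2) : ℝ) = 2 ^ 2 by norm_num]
      exact Real.sqrt_sq (by norm_num)
    rw [hαf, h]
    norm_num
  · rintro t ⟨h0, h1⟩
    have hs : 1 + t ≤ Real.sqrt (2 * (1 + t ^ 2)) :=
      Real.le_sqrt_of_sq_le (by nlinarith [sq_nonneg (1 - t)])
    have hmul := mul_le_mul_of_nonneg_left hs (by linarith : 0 ≤ 1 + t)
    have h2 : t ^ 2 ≤ 1 := pow_le_one₀ h0 h1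
    have h4 : t ^ 4 ≤ 1 := pow_le_one₀ h0 h1
    rw [hαf, div_le_div_iff₀ (by norm_num) (by positivity)]
    nlinarith
  · rintro α hα hα' t ⟨h0, h1⟩
    have h2 : t ^ 2 ≤ 1 := pow_le_one₀ h0 h1
    have h4 : t ^ 4 ≤ 1 := pow_le_one₀ h0 h1
    have hA : 0 ≤ (t ^ 4 + 2 * t ^ 2 + 8 * t + 1) * ((α - 1) * (4 / 3 - α)) :=
      mul_nonneg (by positivity) (mul_nonneg (by linarith) (by linarith))
    have hB : 0 ≤ (α - 1) * (47 - 32 * t - 14 * t ^ 2 - t ^ 4) :=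
      mul_nonneg (by linarith) (by linarith)
    linear_combination hA + hB / 3 + 12 * hα'
end
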